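/- Every modulus of uniform continuity of F grows exponentially: if ω : ℕ → ℕ is such that for all n ∈ ℕ and all x, y ∈ [0,1], |x − y| ≤ 2^{−ω(n)} implies |F(x) − F(y)| ≤ 2^{−n}, then for every n ∈ ℕ it holds that (max(ω(n), 1))³ ≥ 2^n. -/

import Mathlib

open scoped BigOperators

/-- The piecewise linear "step" function `β_{p,q}` on `[0,1]`. -/
noncomputable def beta (p q : ℕ) (x : ℝ) : ℝ :=
  if x ≤ (p : ℝ) / q then 0
  else if x ≤ ((p : ℝ) + (2:ℝ) ^ (-(q:ℤ))) / q then (2:ℝ) ^ q * (x - (p : ℝ) / q)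
  else 1 / q

/-- `α_q(x) = ∑_{p=0}^{q-1} β_{p,q}(x)`. -/
noncomputable def alpha (q : ℕ) (x : ℝ) : ℝ := ∑ p ∈ Finset.range q, beta p q x

/-- `F(x) = ∑_{q=1}^∞ (1/q²)·α_q(x)`. -/
noncomputable def F (x : ℝ) : ℝ := ∑' q : ℕ, (1 / ((q:ℝ) + 1) ^ 2) * alpha (q + 1) x

theorem beta_nonneg (p q : ℕ) (x : ℝ) : 0 ≤ beta p q x := by
  unfold beta
  split_ifs with h₁ h₂
  · exact le_rfl
  · exact mul_nonneg (by positivity) (by linarith)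
  · positivity

theorem beta_le (p q : ℕ) (x : ℝ) : beta p q x ≤ 1 / q := by
  unfold beta
  split_ifs with h₁ h₂
  · positivity
  · have h : x - (p : ℝ) / q ≤ (2 : ℝ) ^ (-(q : ℤ)) / q := by
      rw [add_div] at h₂
      linarith
    calc (2 : ℝ) ^ q * (x - (p : ℝ) / q) ≤ (2 : ℝ) ^ q * ((2 : ℝ) ^ (-(q : ℤ)) / q) := by gcongr
      _ = 1 / q := by
        rw [zpow_neg, zpow_natCast, ← mul_div_assoc, mul_inv_cancel₀ (by positivity)]
  · exact le_rfl

theorem beta_zero_right (p q : ℕ) : beta p q 0 = 0 := by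
  unfold beta
  rw [if_pos (by positivity)]

theorem beta_zero_left_eq {q : ℕ} (hq : 0 < q) : beta 0 q (((2 : ℝ) ^ q)⁻¹ / q) = 1 / q := by
  have hq' : (0 : ℝ) < q := Nat.cast_pos.mpr hq
  have h : ¬ ((2 : ℝ) ^ q)⁻¹ / q ≤ ((0 : ℕ) : ℝ) / q := by
    simp only [Nat.cast_zero, zero_div, not_le]
    positivity
  unfold beta
  rw [if_neg h, if_pos (by simp [zpow_neg, zpow_natCast])]
  simp only [Nat.cast_zero, zero_div, sub_zero]
  field_simp

theorem alpha_nonneg (q : ℕ) (x : ℝ) : 0 ≤ alpha q x :=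
  Finset.sum_nonneg fun p _ => beta_nonneg p q x

theorem alpha_le_one (q : ℕ) (x : ℝ) : alpha q x ≤ 1 := by
  calc alpha q x ≤ ∑ _p ∈ Finset.range q, 1 / (q : ℝ) :=
        Finset.sum_le_sum fun p _ => beta_le p q x
    _ ≤ 1 := by
      rw [Finset.sum_const, Finset.card_range, nsmul_eq_mul, mul_one_div]
      exact div_self_le_one _

theorem beta_le_alpha {p q : ℕ} (hp : p < q) (x : ℝ) : beta p q x ≤ alpha q x :=
  Finset.single_le_sum (f := fun p => beta p q x) (fun p _ => beta_nonneg p q x)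
    (Finset.mem_range.mpr hp)

theorem summable_F (x : ℝ) :
    Summable fun q : ℕ => (1 / ((q : ℝ) + 1) ^ 2) * alpha (q + 1) x := by
  have h : Summable fun q : ℕ => 1 / ((q : ℝ) + 1) ^ 2 := by
    simpa using (summable_nat_add_iff 1).mpr (Real.summable_one_div_nat_pow.mpr one_lt_two)
  refine h.of_nonneg_of_le (fun q => mul_nonneg (by positivity) (alpha_nonneg _ _)) fun q => ?_
  exact mul_le_of_le_one_right (by positivity) (alpha_le_one _ _)

theorem F_zero : F 0 = 0 := by
  simp [F, alpha, beta_zero_right]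

theorem one_div_pow_three_le_F {q : ℕ} (hq : 0 < q) :
    1 / (q : ℝ) ^ 3 ≤ F (((2 : ℝ) ^ q)⁻¹ / q) := by
  obtain ⟨k, rfl⟩ := Nat.exists_eq_add_of_lt hq
  rw [zero_add] at hq ⊢
  set y : ℝ := ((2 : ℝ) ^ (k + 1))⁻¹ / ((k + 1 : ℕ) : ℝ) with hy
  calc 1 / ((k + 1 : ℕ) : ℝ) ^ 3 = (1 / ((k : ℝ) + 1) ^ 2) * beta 0 (k + 1) y := by
        rw [hy, beta_zero_left_eq hq]
        push_cast
        field_simp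
    _ ≤ (1 / ((k : ℝ) + 1) ^ 2) * alpha (k + 1) y := by
        gcongr
        exact beta_le_alpha hq y
    _ ≤ F y := (summable_F y).le_tsum k fun j _ =>
        mul_nonneg (by positivity) (alpha_nonneg _ _)

theorem modulus_grows_exponentially (ω : ℕ → ℕ)
    (hω : ∀ n : ℕ, ∀ x ∈ Set.Icc (0:ℝ) 1, ∀ y ∈ Set.Icc (0:ℝ) 1,
      |x - y| ≤ ((2:ℝ) ^ (ω n))⁻¹ → |F x - F y| ≤ ((2:ℝ) ^ n)⁻¹) :
    ∀ n : ℕ, 2 ^ n ≤ (max (ω n) 1) ^ 3 := by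
  intro n
  set q := max (ω n) 1 with hq
  have hq1 : 1 ≤ q := le_max_right _ _
  have hq1' : (1 : ℝ) ≤ q := Nat.one_le_cast.mpr hq1
  have hy0 : 0 ≤ ((2 : ℝ) ^ q)⁻¹ / q := by positivity
  have hyq : ((2 : ℝ) ^ q)⁻¹ / q ≤ ((2 : ℝ) ^ q)⁻¹ := div_le_self (by positivity) hq1'
  have hy1 : ((2 : ℝ) ^ q)⁻¹ ≤ 1 := inv_le_one_of_one_le₀ (one_le_pow₀ one_le_two)
  have hyω : ((2 : ℝ) ^ q)⁻¹ ≤ ((2 : ℝ) ^ ω n)⁻¹ := by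
    gcongr
    · exact one_le_two
    · exact le_max_left _ _
  have h := hω n _ ⟨hy0, hyq.trans hy1⟩ 0 ⟨le_rfl, zero_le_one⟩
    (by rw [sub_zero, abs_of_nonneg hy0]; exact hyq.trans hyω)
  rw [F_zero, sub_zero] at h
  have h' := (one_div_pow_three_le_F hq1).trans ((le_abs_self _).trans h)
  rw [one_div, inv_le_inv₀ (by positivity) (by positivity)] at h'
  exact_mod_cast h'
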